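/- Let α > 0, x₀ > 0, θ > 0 and σ < 0. Then the set of solutions u of u''(x) + (1 + iσ)² c(x)^(−2) u(x) = 0 on [x₀, ∞) satisfying u(x) → 0 as x → ∞ is a one-dimensional complex vector subspace of the two-dimensional space of all solutions, and it coincides with the set of solutions that are bounded on [x₀, ∞). -/

import Mathlib

open MeasureTheory Set Filter Topology

noncomputable section

/-- The wave speed profile `c(x) = (1 + θ (x₊)^α)^(-1/2)`. -/
def spd (α θ x : ℝ) : ℝ := (1 + θ * (max x 0) ^ α) ^ (-(1 / 2) : ℝ)

/-- The WKB amplitude `b(x) = c(x)^(1/2)`. -/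
def amp (α θ x : ℝ) : ℝ := spd α θ x ^ ((1 : ℝ) / 2)

/-- The WKB phase `φ(x) = ∫₀ˣ c(y)⁻¹ dy`. -/
def phase (α θ x : ℝ) : ℝ := ∫ y in (0:ℝ)..x, (spd α θ y)⁻¹

/-- `M(x) = c(x)^(1/2) (c^(1/2))''(x)` for `x > 0`, and `0` for `x ≤ 0`. -/
def Mfun (α θ x : ℝ) : ℝ :=
  if 0 < x then
    spd α θ x ^ ((1 : ℝ) / 2) * deriv (deriv (fun y => spd α θ y ^ ((1 : ℝ) / 2))) x
  else 0

/-- `M_{x₀} = ∫_{x₀}^∞ |M(x)| dx`. -/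
def Mtail (α θ x₀ : ℝ) : ℝ := ∫ x in Ioi x₀, |Mfun α θ x|

/-- The Volterra operator `K_σ`. -/
def Kop (α θ x₀ σ : ℝ) (f : ℝ → ℂ) (x : ℝ) : ℂ :=
  (2 * Complex.I * (1 + Complex.I * (σ : ℂ)))⁻¹ *
    ((∫ y in x₀..x, (Mfun α θ y : ℂ) * f y *
        Complex.exp (-2 * Complex.I * (1 + Complex.I * (σ : ℂ)) *
          ((phase α θ x - phase α θ y : ℝ) : ℂ))) +
      ∫ y in Ioi x, (Mfun α θ y : ℂ) * f y)

/-- The right-going WKB wave `v^> = b e^{-iφ}`. -/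
def vplus (α θ x : ℝ) : ℂ := (amp α θ x : ℂ) * Complex.exp (-Complex.I * (phase α θ x : ℂ))

/-- The left-going WKB wave `v^< = b e^{iφ}`. -/
def vminus (α θ x : ℝ) : ℂ := (amp α θ x : ℂ) * Complex.exp (Complex.I * (phase α θ x : ℂ))

/-- `S` is a bounded continuous solution on `[x₀,∞)` of `S = e^{-2iφ} + K₀ S`. -/
def IsVolterraSol (α θ x₀ : ℝ) (S : ℝ → ℂ) : Prop :=
  (∃ C, ∀ x ∈ Ici x₀, ‖S x‖ ≤ C) ∧ ContinuousOn S (Ici x₀) ∧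
    ∀ x ∈ Ici x₀, S x = Complex.exp (-2 * Complex.I * (phase α θ x : ℂ)) + Kop α θ x₀ 0 S x

/-- `R_{x₀} = (2i)⁻¹ ∫_{x₀}^∞ M S^>`. -/
def Rx (α θ x₀ : ℝ) (S : ℝ → ℂ) : ℂ :=
  (2 * Complex.I)⁻¹ * ∫ x in Ioi x₀, (Mfun α θ x : ℂ) * S x

/-- A solution of `u'' + (1+iσ)² c⁻² u = 0` on `[x₀,∞)`. -/
def IsSol (α θ x₀ σ : ℝ) (u u' : ℝ → ℂ) : Prop :=
  (∀ x ∈ Ici x₀, HasDerivWithinAt u (u' x) (Ici x₀) x) ∧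
  (∀ x ∈ Ici x₀,
    HasDerivWithinAt u'
      (-(1 + Complex.I * (σ : ℂ)) ^ 2 * ((spd α θ x : ℂ))⁻¹ ^ 2 * u x) (Ici x₀) x)


/-- Forward global existence for a continuous linear differential equation. -/
theorem exists_forall_ge_hasDerivAt_clm {E : Type*} [NormedAddCommGroup E] [NormedSpace ℝ E]
    [CompleteSpace E] {A : ℝ → E →L[ℝ] E} (hA : Continuous A) (t₀ : ℝ) (y₀ : E) :
    ∃ y : ℝ → E, y t₀ = y₀ ∧ ∀ t ≥ t₀, HasDerivAt y (A t (y t)) t := by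
  -- The Banach fixed point theorem in a sup norm weighted by `g⁻¹`
  let g : ℝ → ℝ := fun x => Real.exp (2 * ∫ s in t₀..x, ‖A s‖)
  have hg : ∀ x, HasDerivAt g (g x * (2 * ‖A x‖)) x := fun x =>
    ((hA.norm.integral_hasStrictDerivAt t₀ x).hasDerivAt.const_mul 2).exp
  have hgc : Continuous g := continuous_iff_continuousAt.2 fun x => (hg x).continuousAt
  have hgpos : ∀ x, 0 < g x := fun x => Real.exp_pos _
  have hg0 : g t₀ = 1 := by simp [g]
  have hint : ∀ z : ℝ → E, Continuous z → Continuous fun s => A s (g s • z s) :=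
    fun z hz => hA.clm_apply (hgc.smul hz)
  have hbound : ∀ (z : ℝ → E) (C : ℝ), (∀ s, ‖z s‖ ≤ C) → ∀ x ≥ t₀,
      ‖(g x)⁻¹ • ∫ s in t₀..x, A s (g s • z s)‖ ≤ C / 2 := by
    intro z C hC x hx
    have hC0 : 0 ≤ C := (norm_nonneg _).trans (hC t₀)
    have hKc : Continuous fun s => C / 2 * (g s * (2 * ‖A s‖)) := by fun_prop
    have h1 : ‖∫ s in t₀..x, A s (g s • z s)‖ ≤ ∫ s in t₀..x, C / 2 * (g s * (2 * ‖A s‖)) := by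
      refine intervalIntegral.norm_integral_le_of_norm_le hx
        (Eventually.of_forall fun s _ => ?_) (hKc.intervalIntegrable _ _)
      calc ‖A s (g s • z s)‖ ≤ ‖A s‖ * ‖g s • z s‖ := (A s).le_opNorm _
        _ = ‖A s‖ * (g s * ‖z s‖) := by rw [norm_smul, Real.norm_of_nonneg (hgpos s).le]
        _ ≤ ‖A s‖ * (g s * C) := mul_le_mul_of_nonneg_left
            (mul_le_mul_of_nonneg_left (hC s) (hgpos s).le) (norm_nonneg _)
        _ = C / 2 * (g s * (2 * ‖A s‖)) := by ring
    have h2 : ∫ s in t₀..x, C / 2 * (g s * (2 * ‖A s‖)) = C / 2 * g x - C / 2 * g t₀ :=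
      intervalIntegral.integral_eq_sub_of_hasDerivAt
        (f := fun s => C / 2 * g s) (fun s _ => (hg s).const_mul _) (hKc.intervalIntegrable _ _)
    rw [norm_smul, norm_inv, Real.norm_of_nonneg (hgpos x).le, inv_mul_le_iff₀ (hgpos x)]
    rw [h2, hg0] at h1
    linarith
  have hTc : ∀ z : ℝ → E, Continuous z → Continuous fun x =>
      (g (max x t₀))⁻¹ • (y₀ + ∫ s in t₀..max x t₀, A s (g s • z s)) := by
    intro z hz
    have h1 : Continuous fun x => ∫ s in t₀..x, A s (g s • z s) :=
      intervalIntegral.continuous_primitive (fun a b => (hint z hz).intervalIntegrable a b) t₀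
    have hm : Continuous fun x : ℝ => max x t₀ := by fun_prop
    exact ((hgc.comp hm).inv₀ fun x => (hgpos _).ne').smul
      (continuous_const.add (h1.comp hm))
  have hg1 : ∀ x ≥ t₀, 1 ≤ g x := fun x hx => Real.one_le_exp <|
    mul_nonneg zero_le_two (intervalIntegral.integral_nonneg hx fun s _ => norm_nonneg _)
  let T : BoundedContinuousFunction ℝ E → BoundedContinuousFunction ℝ E := fun z =>
    BoundedContinuousFunction.ofNormedAddCommGroup _ (hTc z z.continuous) (‖y₀‖ + ‖z‖ / 2) <| by
      intro x
      rw [smul_add]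
      refine norm_add_le_of_le ?_ (hbound z _ z.norm_coe_le_norm _ (le_max_right _ _))
      rw [norm_smul, norm_inv, Real.norm_of_nonneg (hgpos _).le]
      exact mul_le_of_le_one_left (norm_nonneg _) (inv_le_one_of_one_le₀ (hg1 _ (le_max_right _ _)))
  have hTv : ∀ z x, T z x = (g (max x t₀))⁻¹ •
      (y₀ + ∫ s in t₀..max x t₀, A s (g s • z s)) := fun _ _ => rfl
  have hT : ContractingWith (1 / 2) T := by
    refine ⟨by norm_num, LipschitzWith.of_dist_le_mul fun z w => ?_⟩
    rw [BoundedContinuousFunction.dist_le (by positivity)]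
    intro x
    have h1 : T z x - T w x = (g (max x t₀))⁻¹ •
        ∫ s in t₀..max x t₀, A s (g s • (z s - w s)) := by
      rw [hTv, hTv, ← smul_sub, add_sub_add_left_eq_sub, ← intervalIntegral.integral_sub
        ((hint z z.continuous).intervalIntegrable _ _)
        ((hint w w.continuous).intervalIntegrable _ _)]
      simp only [smul_sub, map_sub]
    rw [dist_eq_norm, h1]
    refine (hbound (fun s => z s - w s) (dist z w) (fun s => ?_) _ (le_max_right _ _)).trans ?_
    · rw [← dist_eq_norm]; exact BoundedContinuousFunction.dist_coe_le_dist s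
    · simp only [NNReal.coe_div, NNReal.coe_one, NNReal.coe_ofNat]; linarith
  have : Nonempty (BoundedContinuousFunction ℝ E) := ⟨0⟩
  let z := ContractingWith.fixedPoint T hT
  have hz : T z = z := hT.fixedPoint_isFixedPt
  refine ⟨fun x => y₀ + ∫ s in t₀..x, A s (g s • z s), by simp, fun t ht => ?_⟩
  have h1 : z t = (g t)⁻¹ • (y₀ + ∫ s in t₀..t, A s (g s • z s)) := by
    conv_lhs => rw [← hz, hTv, max_eq_left ht]
  have h2 : y₀ + ∫ s in t₀..t, A s (g s • z s) = g t • z t := by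
    rw [h1, smul_inv_smul₀ (hgpos t).ne']
  beta_reduce
  rw [h2]
  exact ((hint z z.continuous).integral_hasStrictDerivAt t₀ t).hasDerivAt.const_add y₀

theorem monotoneOn_Ici_of_hasDerivWithinAt {f f' : ℝ → ℝ} {a : ℝ}
    (hf : ∀ x ∈ Ici a, HasDerivWithinAt f (f' x) (Ici a) x) (h0 : ∀ x ∈ Ici a, 0 ≤ f' x) :
    MonotoneOn f (Ici a) :=
  monotoneOn_of_hasDerivWithinAt_nonneg (convex_Ici a) (fun x hx => (hf x hx).continuousWithinAt)
    (fun x hx => (hf x (interior_subset hx)).mono interior_subset)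
    (fun x hx => h0 x (interior_subset hx))

theorem MonotoneOn.exists_tendsto_atTop {f : ℝ → ℝ} {a C : ℝ} (hf : MonotoneOn f (Ici a))
    (hC : ∀ x ∈ Ici a, f x ≤ C) : ∃ L, Tendsto f atTop (𝓝 L) := by
  have hm : Monotone fun x => f (max x a) := fun x y hxy =>
    hf (mem_Ici.2 (le_max_right _ _)) (mem_Ici.2 (le_max_right _ _)) (max_le_max_right a hxy)
  have hb : BddAbove (range fun x => f (max x a)) :=
    ⟨C, by rintro _ ⟨x, rfl⟩; exact hC _ (mem_Ici.2 (le_max_right _ _))⟩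
  refine ⟨_, (tendsto_atTop_ciSup hm hb).congr' ?_⟩
  filter_upwards [eventually_ge_atTop a] with x hx
  rw [max_eq_left hx]

/-- A function with `f' ≥ k f²`, `k > 0`, on a half-line is nonpositive there. -/
theorem nonpos_of_mul_sq_le_deriv {f f' : ℝ → ℝ} {a k : ℝ} (hk : 0 < k)
    (hf : ∀ x ∈ Ici a, HasDerivWithinAt f (f' x) (Ici a) x)
    (hf' : ∀ x ∈ Ici a, k * f x ^ 2 ≤ f' x) : ∀ x ∈ Ici a, f x ≤ 0 := by
  have hmono : MonotoneOn f (Ici a) := monotoneOn_Ici_of_hasDerivWithinAt hf fun x hx =>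
    (by positivity : 0 ≤ k * f x ^ 2).trans (hf' x hx)
  intro b hb
  by_contra! hpos
  have hsub : Ici b ⊆ Ici a := Ici_subset_Ici.2 hb
  have hfpos : ∀ x ∈ Ici b, 0 < f x := fun x hx => hpos.trans_le (hmono hb (hsub hx) hx)
  have hG : MonotoneOn (fun x => -(f x)⁻¹ - k * x) (Ici b) := by
    refine monotoneOn_Ici_of_hasDerivWithinAt (f' := fun x => -(-f' x / f x ^ 2) - k * 1)
      (fun x hx => ?_) fun x hx => ?_
    · exact (((hf x (hsub hx)).mono hsub).inv (hfpos x hx).ne').neg.sub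
        ((hasDerivWithinAt_id x _).const_mul k)
    · have h1 := hf' x (hsub hx)
      have h2 : 0 < f x ^ 2 := pow_pos (hfpos x hx) 2
      have h3 : k ≤ f' x / f x ^ 2 := (le_div_iff₀ h2).2 h1
      have h4 : -f' x / f x ^ 2 = -(f' x / f x ^ 2) := neg_div _ _
      rw [h4]
      linarith
  have hd : 0 < (f b)⁻¹ / k := by positivity
  have hx : b + (f b)⁻¹ / k ∈ Ici b := le_add_of_nonneg_right hd.le
  have h1 := hG self_mem_Ici hx hx
  have h2 : 0 < (f (b + (f b)⁻¹ / k))⁻¹ := inv_pos.2 (hfpos _ hx)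
  have h3 : k * ((f b)⁻¹ / k) = (f b)⁻¹ := by field_simp
  simp only at h1
  linarith

/-- If `f ≤ 0` and `f'` dominates both `g` and `|g'|`, with `g ≥ 0`, then `g` tends to
zero. -/
theorem tendsto_zero_of_le_deriv {f f' g g' : ℝ → ℝ} {a : ℝ}
    (hf : ∀ x ∈ Ici a, HasDerivWithinAt f (f' x) (Ici a) x)
    (hg : ∀ x ∈ Ici a, HasDerivWithinAt g (g' x) (Ici a) x)
    (hf0 : ∀ x ∈ Ici a, f x ≤ 0) (hg0 : ∀ x ∈ Ici a, 0 ≤ g x)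
    (hgf : ∀ x ∈ Ici a, g x ≤ f' x) (hgf' : ∀ x ∈ Ici a, |g' x| ≤ f' x) :
    Tendsto g atTop (𝓝 0) := by
  have hmf : MonotoneOn f (Ici a) := monotoneOn_Ici_of_hasDerivWithinAt hf fun x hx =>
    (hg0 x hx).trans (hgf x hx)
  have hsub : MonotoneOn (fun x => f x - g x) (Ici a) :=
    monotoneOn_Ici_of_hasDerivWithinAt (fun x hx => (hf x hx).sub (hg x hx)) fun x hx => by
      linarith [(abs_le.1 (hgf' x hx)).2]
  obtain ⟨L₁, h₁⟩ := hmf.exists_tendsto_atTop hf0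
  obtain ⟨L₂, h₂⟩ := hsub.exists_tendsto_atTop fun x hx =>
    show f x - g x ≤ 0 by linarith [hf0 x hx, hg0 x hx]
  have hL : Tendsto g atTop (𝓝 (L₁ - L₂)) := (h₁.sub h₂).congr fun x => by ring
  have hL0 : 0 ≤ L₁ - L₂ := ge_of_tendsto hL ((eventually_ge_atTop a).mono hg0)
  rcases hL0.eq_or_lt with h | h
  · rwa [← h] at hL
  exfalso
  set L := L₁ - L₂
  obtain ⟨b, hb⟩ := eventually_atTop.1
    ((hL.eventually (lt_mem_nhds (half_lt_self h))).and (eventually_ge_atTop a))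
  have hba : Ici b ⊆ Ici a := Ici_subset_Ici.2 (hb b le_rfl).2
  have hm : MonotoneOn (fun x => f x - L / 2 * x) (Ici b) :=
    monotoneOn_Ici_of_hasDerivWithinAt (f' := fun x => f' x - L / 2 * 1)
      (fun x hx => ((hf x (hba hx)).mono hba).sub ((hasDerivWithinAt_id x _).const_mul _))
      fun x hx => by linarith [(hb x hx).1, hgf x (hba hx)]
  have hd : 0 ≤ (1 - f b) / (L / 2) := div_nonneg (by linarith [hf0 b (hba self_mem_Ici)])
    (half_pos h).le
  have hx : b + (1 - f b) / (L / 2) ∈ Ici b := le_add_of_nonneg_right hd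
  have h1 := hm self_mem_Ici hx hx
  have h2 := hf0 _ (hba hx)
  have h3 : L / 2 * ((1 - f b) / (L / 2)) = 1 - f b := mul_div_cancel₀ _ (half_pos h).ne'
  simp only at h1
  linarith

theorem exists_norm_le_of_tendsto_atTop {u : ℝ → ℂ} {a : ℝ} {l : ℂ}
    (hc : ContinuousOn u (Ici a)) (h : Tendsto u atTop (𝓝 l)) :
    ∃ C, ∀ x ∈ Ici a, ‖u x‖ ≤ C := by
  obtain ⟨b, hb⟩ := eventually_atTop.1 (h.norm.eventually (gt_mem_nhds (lt_add_one ‖l‖)))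
  obtain ⟨C, hC⟩ := (isCompact_Icc (a := a) (b := b)).exists_bound_of_continuousOn
    (hc.mono Icc_subset_Ici_self)
  refine ⟨max C (‖l‖ + 1), fun x hx => ?_⟩
  rcases le_total x b with h | h
  · exact (hC x ⟨hx, h⟩).trans (le_max_left _ _)
  · exact (hb x h).le.trans (le_max_right _ _)

/-- The potential `c⁻²`. -/
def potential (α θ x : ℝ) : ℝ := (spd α θ x)⁻¹ ^ 2

theorem one_le_potential {α θ : ℝ} (hθ : 0 < θ) (x : ℝ) : 1 ≤ potential α θ x := by
  have h : 1 ≤ 1 + θ * (max x 0) ^ α :=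
    le_add_of_nonneg_right (mul_nonneg hθ.le (Real.rpow_nonneg (le_max_right _ _) _))
  have h1 : 0 < spd α θ x := Real.rpow_pos_of_pos (by linarith) _
  have h2 : spd α θ x ≤ 1 := Real.rpow_le_one_of_one_le_of_nonpos h (by norm_num)
  exact one_le_pow₀ ((one_le_inv₀ h1).2 h2)

theorem continuous_potential {α θ : ℝ} (hα : 0 < α) (hθ : 0 < θ) :
    Continuous (potential α θ) := by
  have h : ∀ x, 0 < 1 + θ * (max x 0) ^ α := fun x =>
    add_pos_of_pos_of_nonneg one_pos (mul_nonneg hθ.le (Real.rpow_nonneg (le_max_right _ _) _))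
  have h1 : Continuous fun x : ℝ => 1 + θ * (max x 0) ^ α :=
    continuous_const.add (continuous_const.mul
      ((continuous_id.max continuous_const).rpow_const fun _ => Or.inr hα.le))
  have h2 : Continuous (spd α θ) := h1.rpow_const fun x => Or.inl (h x).ne'
  exact (h2.inv₀ fun x => (Real.rpow_pos_of_pos (h x) _).ne').pow 2

/-- The rotated flux `Re (conj (μ u) u')` with `μ = -σ + i`, a square root of `-(1 + iσ)²`. -/
def flux (σ : ℝ) (u u' : ℝ → ℂ) (x : ℝ) : ℝ := inner ℝ ((-(σ : ℂ) + Complex.I) * u x) (u' x)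

/-- The derivative of the flux along solutions. -/
def fluxDeriv (α θ σ : ℝ) (u u' : ℝ → ℂ) (x : ℝ) : ℝ :=
  -σ * (‖u' x‖ ^ 2 + (1 + σ ^ 2) * potential α θ x * ‖u x‖ ^ 2)

section

variable {α θ x₀ σ : ℝ} {u u' v v' : ℝ → ℂ}

theorem IsSol.smul_add_smul (hu : IsSol α θ x₀ σ u u') (hv : IsSol α θ x₀ σ v v') (a b : ℂ) :
    IsSol α θ x₀ σ (fun x => a * u x + b * v x) (fun x => a * u' x + b * v' x) :=
  ⟨fun x hx => ((hu.1 x hx).const_mul a).add ((hv.1 x hx).const_mul b), fun x hx =>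
    (((hu.2 x hx).const_mul a).add ((hv.2 x hx).const_mul b)).congr_deriv (by ring)⟩

theorem IsSol.hasDerivWithinAt_flux (hu : IsSol α θ x₀ σ u u') {x : ℝ} (hx : x ∈ Ici x₀) :
    HasDerivWithinAt (flux σ u u') (fluxDeriv α θ σ u u' x) (Ici x₀) x := by
  refine (((hu.1 x hx).const_mul (-(σ : ℂ) + Complex.I)).inner ℝ (hu.2 x hx)).congr_deriv ?_
  have h : ((spd α θ x : ℂ))⁻¹ ^ 2 = (potential α θ x : ℂ) := by simp [potential]
  rw [h]
  simp only [fluxDeriv, Complex.inner, Complex.sq_norm, Complex.normSq_apply]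
  simp only [Complex.mul_re, Complex.mul_im, Complex.conj_re, Complex.conj_im, Complex.add_re,
    Complex.add_im, Complex.neg_re, Complex.neg_im, Complex.ofReal_re, Complex.ofReal_im,
    Complex.I_re, Complex.I_im, Complex.one_re, Complex.one_im, pow_two]
  ring

theorem mul_norm_sq_le_fluxDeriv (hθ : 0 < θ) (hσ : σ < 0) (x : ℝ) :
    -σ * (‖u' x‖ ^ 2 + ‖u x‖ ^ 2) ≤ fluxDeriv α θ σ u u' x := by
  have h : 1 ≤ (1 + σ ^ 2) * potential α θ x :=
    one_le_mul_of_one_le_of_one_le (by nlinarith) (one_le_potential hθ x)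
  refine mul_le_mul_of_nonneg_left ?_ (by linarith)
  nlinarith [sq_nonneg ‖u x‖]

theorem IsSol.monotoneOn_flux (hθ : 0 < θ) (hσ : σ < 0) (hu : IsSol α θ x₀ σ u u') :
    MonotoneOn (flux σ u u') (Ici x₀) :=
  monotoneOn_Ici_of_hasDerivWithinAt (fun _ hx => hu.hasDerivWithinAt_flux hx) fun x _ =>
    le_trans (mul_nonneg (by linarith) (by positivity)) (mul_norm_sq_le_fluxDeriv hθ hσ x)

theorem IsSol.flux_nonpos_of_bounded (hθ : 0 < θ) (hσ : σ < 0) (hu : IsSol α θ x₀ σ u u')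
    (hb : ∃ C, ∀ x ∈ Ici x₀, ‖u x‖ ≤ C) : ∀ x ∈ Ici x₀, flux σ u u' x ≤ 0 := by
  obtain ⟨C, hC⟩ := hb
  have hC0 : 0 ≤ C := (norm_nonneg _).trans (hC x₀ self_mem_Ici)
  set B := ‖-(σ : ℂ) + Complex.I‖ * (C + 1)
  have hμ : 0 < ‖-(σ : ℂ) + Complex.I‖ := norm_pos_iff.2 fun h => by
    simpa using congrArg Complex.im h
  have hB : 0 < B := by positivity
  refine nonpos_of_mul_sq_le_deriv (k := -σ / B ^ 2) (div_pos (by linarith) (by positivity))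
    (fun x hx => hu.hasDerivWithinAt_flux hx) fun x hx => ?_
  have h1 : |flux σ u u' x| ≤ B * ‖u' x‖ := by
    refine (abs_real_inner_le_norm _ _).trans (mul_le_mul_of_nonneg_right ?_ (norm_nonneg _))
    rw [norm_mul]
    exact mul_le_mul_of_nonneg_left ((hC x hx).trans (by linarith)) (norm_nonneg _)
  have h2 : flux σ u u' x ^ 2 ≤ B ^ 2 * ‖u' x‖ ^ 2 := by
    rw [← sq_abs, ← mul_pow]
    exact pow_le_pow_left₀ (abs_nonneg _) h1 2
  calc -σ / B ^ 2 * flux σ u u' x ^ 2 ≤ -σ / B ^ 2 * (B ^ 2 * ‖u' x‖ ^ 2) :=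
        mul_le_mul_of_nonneg_left h2 (div_nonneg (by linarith) (by positivity))
    _ = -σ * ‖u' x‖ ^ 2 := by field_simp
    _ ≤ -σ * (‖u' x‖ ^ 2 + ‖u x‖ ^ 2) :=
        mul_le_mul_of_nonneg_left (le_add_of_nonneg_right (by positivity)) (by linarith)
    _ ≤ _ := mul_norm_sq_le_fluxDeriv hθ hσ x

theorem IsSol.tendsto_zero_of_flux_nonpos (hθ : 0 < θ) (hσ : σ < 0) (hu : IsSol α θ x₀ σ u u')
    (hF : ∀ x ∈ Ici x₀, flux σ u u' x ≤ 0) : Tendsto u atTop (𝓝 0) := by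
  have key : Tendsto (fun x => -σ * ‖u x‖ ^ 2) atTop (𝓝 0) := by
    refine tendsto_zero_of_le_deriv (fun x hx => hu.hasDerivWithinAt_flux hx)
      (fun x hx => (hu.1 x hx).norm_sq.const_mul (-σ)) hF
      (fun x _ => mul_nonneg (by linarith) (by positivity)) (fun x _ => ?_) fun x _ => ?_
    · exact le_trans (mul_le_mul_of_nonneg_left (le_add_of_nonneg_left (by positivity))
        (by linarith)) (mul_norm_sq_le_fluxDeriv hθ hσ x)
    · refine le_trans ?_ (mul_norm_sq_le_fluxDeriv hθ hσ x)
      rw [abs_mul, abs_of_pos (neg_pos.2 hσ), abs_mul, abs_two]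
      refine mul_le_mul_of_nonneg_left ?_ (by linarith)
      nlinarith [abs_real_inner_le_norm (u x) (u' x), sq_nonneg (‖u x‖ - ‖u' x‖)]
  have h2 : Tendsto (fun x => ‖u x‖ ^ 2) atTop (𝓝 0) := by
    have h := key.const_mul (-σ)⁻¹
    rw [mul_zero] at h
    exact h.congr fun x => inv_mul_cancel_left₀ (neg_pos.2 hσ).ne' _
  have h3 := h2.sqrt
  simp only [Real.sqrt_zero, Real.sqrt_sq (norm_nonneg _)] at h3
  exact tendsto_zero_iff_norm_tendsto_zero.2 h3

theorem IsSol.tendsto_zero_iff_bounded (hθ : 0 < θ) (hσ : σ < 0) (hu : IsSol α θ x₀ σ u u') :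
    Tendsto u atTop (𝓝 0) ↔ ∃ C, ∀ x ∈ Ici x₀, ‖u x‖ ≤ C :=
  ⟨exists_norm_le_of_tendsto_atTop fun x hx => (hu.1 x hx).continuousWithinAt, fun h =>
    hu.tendsto_zero_of_flux_nonpos hθ hσ (hu.flux_nonpos_of_bounded hθ hσ h)⟩

/-- A decaying solution that vanishes at the endpoint is zero. -/
theorem IsSol.eq_zero_of_tendsto_zero (hθ : 0 < θ) (hσ : σ < 0) (hu : IsSol α θ x₀ σ u u')
    (h : Tendsto u atTop (𝓝 0)) (h0 : u x₀ = 0) : ∀ x ∈ Ici x₀, u x = 0 := by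
  have hF := hu.flux_nonpos_of_bounded hθ hσ ((hu.tendsto_zero_iff_bounded hθ hσ).1 h)
  have hF0 : ∀ x ∈ Ici x₀, flux σ u u' x = 0 := fun x hx => le_antisymm (hF x hx) <| by
    have := hu.monotoneOn_flux hθ hσ self_mem_Ici hx hx
    simpa [flux, h0] using this
  intro x hx
  have h1 : HasDerivWithinAt (flux σ u u') 0 (Ici x₀) x :=
    (hasDerivWithinAt_const x (Ici x₀) (0 : ℝ)).congr hF0 (hF0 x hx)
  have h2 := (uniqueDiffOn_Ici x₀ x hx).eq_deriv _ h1 (hu.hasDerivWithinAt_flux hx)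
  have h3 := mul_norm_sq_le_fluxDeriv (α := α) (u := u) (u' := u') hθ hσ x
  rw [← h2] at h3
  have h4 : ‖u' x‖ ^ 2 + ‖u x‖ ^ 2 ≤ 0 := nonpos_of_mul_nonpos_right h3 (neg_pos.2 hσ)
  have h5 : ‖u x‖ ^ 2 = 0 := le_antisymm (by nlinarith [sq_nonneg ‖u' x‖]) (sq_nonneg _)
  exact norm_eq_zero.1 (pow_eq_zero_iff two_ne_zero |>.1 h5)

/-- The initial value problem is globally solvable. -/
theorem exists_isSol (hα : 0 < α) (hθ : 0 < θ) (x₀ σ : ℝ) (a b : ℂ) :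
    ∃ u u' : ℝ → ℂ, IsSol α θ x₀ σ u u' ∧ u x₀ = a ∧ u' x₀ = b := by
  let A : ℝ → (ℂ × ℂ) →L[ℝ] (ℂ × ℂ) := fun t =>
    (ContinuousLinearMap.inl ℝ ℂ ℂ).comp (ContinuousLinearMap.snd ℝ ℂ ℂ) +
      (-(1 + Complex.I * (σ : ℂ)) ^ 2 * (potential α θ t : ℂ)) •
        (ContinuousLinearMap.inr ℝ ℂ ℂ).comp (ContinuousLinearMap.fst ℝ ℂ ℂ)
  have hA : Continuous A := continuous_const.add <| Continuous.smul
    (continuous_const.mul (Complex.continuous_ofReal.comp (continuous_potential hα hθ)))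
    continuous_const
  obtain ⟨y, hy0, hy⟩ := exists_forall_ge_hasDerivAt_clm hA x₀ (a, b)
  refine ⟨fun x => (y x).1, fun x => (y x).2, ⟨fun x hx => ?_, fun x hx => ?_⟩, by simp [hy0],
    by simp [hy0]⟩
  · have h := (hasFDerivAt_fst.comp_hasDerivAt x (hy x hx)).hasDerivWithinAt (s := Ici x₀)
    exact h.congr_deriv (by simp [A])
  · have h := (hasFDerivAt_snd.comp_hasDerivAt x (hy x hx)).hasDerivWithinAt (s := Ici x₀)
    exact h.congr_deriv (by simp [A, potential])

/-- There is a nonzero solution with nonpositive flux: a limit of solutions vanishing at `x₀ + n`. -/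
theorem exists_isSol_flux_nonpos (hα : 0 < α) (hθ : 0 < θ) (hσ : σ < 0) (x₀ : ℝ) :
    ∃ u u' : ℝ → ℂ, IsSol α θ x₀ σ u u' ∧ (∃ x ∈ Ici x₀, u x ≠ 0) ∧
      ∀ x ∈ Ici x₀, flux σ u u' x ≤ 0 := by
  obtain ⟨φ, φ', hφ, hφ0, hφ0'⟩ := exists_isSol hα hθ x₀ σ 1 0
  obtain ⟨ψ, ψ', hψ, hψ0, hψ0'⟩ := exists_isSol hα hθ x₀ σ 0 1
  have hsol := fun z : ℂ × ℂ => hφ.smul_add_smul hψ z.1 z.2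
  let F : ℂ × ℂ → ℝ → ℝ := fun z =>
    flux σ (fun x => z.1 * φ x + z.2 * ψ x) (fun x => z.1 * φ' x + z.2 * ψ' x)
  have hFm : ∀ z, MonotoneOn (F z) (Ici x₀) := fun z => (hsol z).monotoneOn_flux hθ hσ
  have hxn : ∀ n : ℕ, x₀ + n ∈ Ici x₀ := fun n =>
    mem_Ici.2 (le_add_of_nonneg_right n.cast_nonneg)
  let K : ℕ → Set (ℂ × ℂ) := fun n => Metric.sphere 0 1 ∩ {z | F z (x₀ + n) ≤ 0}
  have hcl : ∀ n, IsClosed (K n) := fun n => Metric.isClosed_sphere.inter <|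
    isClosed_le (by simp only [F, flux]; fun_prop) continuous_const
  obtain ⟨z, hz⟩ : (⋂ n, K n).Nonempty := by
    refine IsCompact.nonempty_iInter_of_sequence_nonempty_isCompact_isClosed K (fun n z hz => ?_)
      (fun n => ?_) ((isCompact_sphere _ _).inter_right ?_) hcl
    · refine ⟨hz.1, le_trans (hFm z (hxn _) (hxn _) ?_) hz.2⟩
      push_cast
      linarith
    · obtain ⟨w, hw, hw0⟩ : ∃ w : ℂ × ℂ, w ≠ 0 ∧ w.1 * φ (x₀ + n) + w.2 * ψ (x₀ + n) = 0 := by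
        by_cases h : ψ (x₀ + n) = 0
        · exact ⟨(0, 1), by simp, by simp [h]⟩
        · exact ⟨(ψ (x₀ + n), -φ (x₀ + n)), by simp [h], by ring⟩
      have hr : ((‖w‖ : ℂ)⁻¹ * w.1) * φ (x₀ + n) + ((‖w‖ : ℂ)⁻¹ * w.2) * ψ (x₀ + n) = 0 := by
        linear_combination (‖w‖ : ℂ)⁻¹ * hw0
      refine ⟨(‖w‖ : ℂ)⁻¹ • w, ?_, ?_⟩
      · rw [mem_sphere_zero_iff_norm, norm_smul, norm_inv, Complex.norm_real, norm_norm,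
          inv_mul_cancel₀ (norm_ne_zero_iff.2 hw)]
      · simp only [mem_ofPred_eq, F, flux, Prod.smul_fst, Prod.smul_snd, smul_eq_mul, hr, mul_zero,
          inner_zero_left, le_refl]
    · exact isClosed_le (by simp only [F, flux]; fun_prop) continuous_const
  rw [mem_iInter] at hz
  refine ⟨_, _, hsol z, ?_, fun x hx => ?_⟩
  · by_contra! h
    have h1 : z.1 = 0 := by simpa [hφ0, hψ0] using h x₀ self_mem_Ici
    have h2 : HasDerivWithinAt (fun x => z.1 * φ x + z.2 * ψ x) 0 (Ici x₀) x₀ :=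
      (hasDerivWithinAt_const x₀ (Ici x₀) (0 : ℂ)).congr h (h x₀ self_mem_Ici)
    have h3 := (uniqueDiffOn_Ici x₀ x₀ self_mem_Ici).eq_deriv _ h2 ((hsol z).1 x₀ self_mem_Ici)
    have h4 : z.2 = 0 := by simpa [hφ0', hψ0'] using h3.symm
    have h5 : z = 0 := Prod.ext h1 h4
    simpa [h5] using (hz 0).1
  · obtain ⟨n, hn⟩ := exists_nat_ge (x - x₀)
    exact (hFm z hx (hxn n) (by linarith)).trans (hz n).2

end

/-- the decaying solutions form a one-dimensional space, equal to the
bounded solutions. -/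
theorem stmt16 (α θ x₀ σ : ℝ) (hα : 0 < α) (hθ : 0 < θ) (hx₀ : 0 < x₀) (hσ : σ < 0) :
    (∃ u u' : ℝ → ℂ, IsSol α θ x₀ σ u u' ∧ (∃ x ∈ Ici x₀, u x ≠ 0) ∧
      Tendsto u atTop (𝓝 0)) ∧
    (∀ u u' v v' : ℝ → ℂ, IsSol α θ x₀ σ u u' → IsSol α θ x₀ σ v v' →
      Tendsto u atTop (𝓝 0) → Tendsto v atTop (𝓝 0) →
      ∃ a : ℂ, (∀ x ∈ Ici x₀, v x = a * u x) ∨ (∀ x ∈ Ici x₀, u x = a * v x)) ∧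
    (∀ u u' : ℝ → ℂ, IsSol α θ x₀ σ u u' →
      (Tendsto u atTop (𝓝 0) ↔ ∃ C, ∀ x ∈ Ici x₀, ‖u x‖ ≤ C)) := by
  refine ⟨?_, fun u u' v v' hu hv hut hvt => ?_, fun u u' hu => hu.tendsto_zero_iff_bounded hθ hσ⟩
  · obtain ⟨u, u', hu, hne, hF⟩ := exists_isSol_flux_nonpos hα hθ hσ x₀
    exact ⟨u, u', hu, hne, hu.tendsto_zero_of_flux_nonpos hθ hσ hF⟩
  · by_cases h0 : u x₀ = 0
    · refine ⟨0, Or.inr fun x hx => ?_⟩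
      rw [hu.eq_zero_of_tendsto_zero hθ hσ hut h0 x hx, zero_mul]
    · refine ⟨v x₀ / u x₀, Or.inl fun x hx => ?_⟩
      have hw := (hv.smul_add_smul hu 1 (-(v x₀ / u x₀))).eq_zero_of_tendsto_zero hθ hσ
        (by simpa using (hvt.const_mul 1).add (hut.const_mul (-(v x₀ / u x₀))))
        (by field_simp; ring) x hx
      linear_combination hw
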